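/- (Singular Trudinger–Moser inequality, uniform part) Let Ω ⊂ ℝ² be a bounded domain containing the origin, α > 0, β ∈ [0,2). The supremum of ∫_Ω e^{α u²}/|x|^β dx over all u ∈ H¹₀(Ω) with ‖∇u‖_{L²} ≤ 1 is finite if and only if α/(4π) + β/2 ≤ 1. -/

import Mathlib

open MeasureTheory Real ENNReal

namespace TrudingerMoser

open Set Metric Filter Topology

local notation "ℝ²" => EuclideanSpace ℝ (Fin 2)

lemma toSphere_univ : (volume : Measure ℝ²).toSphere univ = ENNReal.ofReal (2 * π) := by
  rw [Measure.toSphere_apply_univ, EuclideanSpace.volume_ball]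
  simp [Real.sq_sqrt pi_pos.le, ENNReal.ofReal_mul, one_add_one_eq_two]

lemma lintegral_polar {f : ℝ² → ℝ≥0∞} (hf : Measurable f) :
    ∫⁻ x, f x = ∫⁻ θ : sphere (0 : ℝ²) 1, (∫⁻ r in Ioi (0 : ℝ), ENNReal.ofReal r * f (r • θ.1))
      ∂(volume : Measure ℝ²).toSphere := by
  have hg : Measurable fun p : sphere (0 : ℝ²) 1 × Ioi (0 : ℝ) => f (p.2.1 • p.1.1) := by
    fun_prop
  calc ∫⁻ x, f x = ∫⁻ x in ({0}ᶜ : Set ℝ²), f x := by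
        rw [restrict_compl_singleton]
    _ = ∫⁻ x : ({0}ᶜ : Set ℝ²), f x ∂(volume.comap Subtype.val) := by
        rw [lintegral_subtype_comap (measurableSet_singleton _).compl]
    _ = ∫⁻ x : ({0}ᶜ : Set ℝ²), (fun p : sphere (0 : ℝ²) 1 × Ioi (0 : ℝ) => f (p.2.1 • p.1.1))
          (homeomorphUnitSphereProd ℝ² x) ∂(volume.comap Subtype.val) := by
        refine lintegral_congr fun x => ?_
        have : ‖x.1‖ ≠ 0 := norm_ne_zero_iff.2 x.2
        simp [smul_smul, this]
    _ = _ := by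
        rw [(volume : Measure ℝ²).measurePreserving_homeomorphUnitSphereProd.lintegral_comp hg,
          lintegral_prod _ hg.aemeasurable]
        refine lintegral_congr fun θ => ?_
        rw [Measure.volumeIoiPow, lintegral_withDensity_eq_lintegral_mul _ (by fun_prop)
          (by fun_prop), ← lintegral_subtype_comap measurableSet_Ioi]
        simp

lemma lintegral_radial {g : ℝ → ℝ≥0∞} (hg : Measurable g) :
    ∫⁻ x : ℝ², g ‖x‖ = ENNReal.ofReal (2 * π) * ∫⁻ r in Ioi (0 : ℝ), ENNReal.ofReal r * g r := by
  rw [lintegral_polar (f := fun x => g ‖x‖) (by fun_prop)]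
  have : ∀ θ : sphere (0 : ℝ²) 1, (∫⁻ r in Ioi (0 : ℝ), ENNReal.ofReal r * g ‖r • θ.1‖)
      = ∫⁻ r in Ioi (0 : ℝ), ENNReal.ofReal r * g r := fun θ => by
    refine setLIntegral_congr_fun measurableSet_Ioi fun r (hr : 0 < r) => ?_
    simp [norm_smul, abs_of_pos hr]
  simp_rw [this, lintegral_const, toSphere_univ, mul_comm]

/-- The set-integral version of `lintegral_radial`. -/
lemma setLIntegral_radial {g : ℝ → ℝ≥0∞} (hg : Measurable g) {I : Set ℝ} (hI : MeasurableSet I)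
    (hI0 : I ⊆ Ioi 0) :
    ∫⁻ x in {x : ℝ² | ‖x‖ ∈ I}, g ‖x‖ =
      ENNReal.ofReal (2 * π) * ∫⁻ r in I, ENNReal.ofReal r * g r := by
  have hm : MeasurableSet {x : ℝ² | ‖x‖ ∈ I} := measurable_norm hI
  rw [← lintegral_indicator hm]
  have := lintegral_radial (hg.indicator hI)
  refine Eq.trans ?_ (this.trans ?_)
  · rfl
  congr 1
  rw [← inter_eq_self_of_subset_left hI0, ← setLIntegral_indicator hI]
  refine lintegral_congr fun r => ?_
  by_cases hr : r ∈ I <;> simp [hr, show I ∩ Ioi 0 = I from inter_eq_self_of_subset_left hI0]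

lemma setLIntegral_radial_rpow {p R : ℝ} (hp : p < 2) (hR : 0 < R) :
    ∫⁻ x in ball (0 : ℝ²) R, ENNReal.ofReal (‖x‖ ^ (-p)) =
      ENNReal.ofReal (2 * π / (2 - p) * R ^ (2 - p)) := by
  have h1 : ∫⁻ x in ball (0 : ℝ²) R, ENNReal.ofReal (‖x‖ ^ (-p)) =
      ∫⁻ x in {x : ℝ² | ‖x‖ ∈ Ioo 0 R}, ENNReal.ofReal (‖x‖ ^ (-p)) := by
    refine setLIntegral_congr ?_
    have : {x : ℝ² | ‖x‖ ∈ Ioo 0 R} = ball 0 R \ {0} := by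
      ext x; simp [and_comm]
    rw [this]
    exact (sdiff_null_ae_eq_self (measure_singleton _)).symm
  rw [h1, setLIntegral_radial (g := fun r => ENNReal.ofReal (r ^ (-p))) (by fun_prop)
    measurableSet_Ioo (fun r hr => hr.1)]
  have h2 : ∫⁻ r in Ioo 0 R, ENNReal.ofReal r * ENNReal.ofReal (r ^ (-p)) =
      ENNReal.ofReal (∫ r in (0 : ℝ)..R, r ^ (1 - p)) := by
    have hi := intervalIntegral.intervalIntegrable_rpow' (a := 0) (b := R) (r := 1 - p)
      (by linarith)
    rw [intervalIntegral.integral_of_le hR.le, ofReal_integral_eq_lintegral_ofReal hi.1,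
      Measure.restrict_congr_set Ioo_ae_eq_Ioc]
    · refine setLIntegral_congr_fun measurableSet_Ioc fun r hr => ?_
      rw [← ENNReal.ofReal_mul hr.1.le, sub_eq_add_neg, rpow_add hr.1, Real.rpow_one]
    · filter_upwards [ae_restrict_mem measurableSet_Ioc] with y hy
      exact rpow_nonneg hy.1.le _
  rw [h2, integral_rpow (Or.inl (by linarith)), ← ENNReal.ofReal_mul (by positivity)]
  congr 1
  rw [zero_rpow (by linarith), show 1 - p + 1 = 2 - p by ring]
  ring

lemma setLIntegral_annulus {r R : ℝ} (hr : 0 < r) (hR : r ≤ R) :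
    ∫⁻ x in {x : ℝ² | ‖x‖ ∈ Ico r R}, ENNReal.ofReal ((‖x‖ ^ 2)⁻¹) =
      ENNReal.ofReal (2 * π * Real.log (R / r)) := by
  rw [setLIntegral_radial (g := fun r => ENNReal.ofReal ((r ^ 2)⁻¹)) (by fun_prop)
    measurableSet_Ico (fun x hx => hr.trans_le hx.1), Measure.restrict_congr_set Ico_ae_eq_Ioc]
  have hi : IntervalIntegrable (fun x : ℝ => x⁻¹) volume r R :=
    intervalIntegral.intervalIntegrable_inv (fun x hx => by
      rw [uIcc_of_le hR] at hx; exact (hr.trans_le hx.1).ne') continuousOn_id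
  have h2 : ∫⁻ s in Ioc r R, ENNReal.ofReal s * ENNReal.ofReal ((s ^ 2)⁻¹) =
      ENNReal.ofReal (∫ s in r..R, s⁻¹) := by
    rw [intervalIntegral.integral_of_le hR, ofReal_integral_eq_lintegral_ofReal hi.1]
    · refine setLIntegral_congr_fun measurableSet_Ioc fun s hs => ?_
      have : 0 < s := hr.trans hs.1
      rw [← ENNReal.ofReal_mul this.le]
      congr 1; field_simp
    · filter_upwards [ae_restrict_mem measurableSet_Ioc] with y hy
      exact inv_nonneg.2 (hr.trans hy.1).le
  rw [h2, integral_inv_of_pos hr (hr.trans_le hR), ← ENNReal.ofReal_mul (by positivity)]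

lemma ofReal_sub_le_lintegral_deriv {φ φ' : ℝ → ℝ} (hφ : ∀ r, HasDerivAt φ (φ' r) r)
    (hc : Continuous φ') {R : ℝ} (hR : 0 ≤ R) (hφR : φ R = 0)
    {a b : ℝ} (ha : 0 ≤ a) (h0 : b ≤ |φ 0|) :
    ENNReal.ofReal (b - a) ≤
      ∫⁻ r in Ioi 0, {r | a < |φ r| ∧ |φ r| < b}.indicator (fun r => ‖φ' r‖ₑ) r := by
  have hφc : Continuous φ := continuous_iff_continuousAt.2 fun r => (hφ r).continuousAt
  obtain ⟨r₁, hr₁, hmax⟩ := (isCompact_Icc.inter_right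
    (isClosed_le continuous_const hφc.abs : IsClosed {r | b ≤ |φ r|})).exists_isGreatest
    (⟨0, left_mem_Icc.2 hR, h0⟩ : (Icc 0 R ∩ {r | b ≤ |φ r|}).Nonempty)
  obtain ⟨r₂, hr₂, hmin⟩ := (isCompact_Icc.inter_right
    (isClosed_le hφc.abs continuous_const : IsClosed {r | |φ r| ≤ a})).exists_isLeast
    (⟨R, right_mem_Icc.2 hr₁.1.2, by simp [hφR, ha]⟩ : (Icc r₁ R ∩ {r | |φ r| ≤ a}).Nonempty)
  have hsub : Ioo r₁ r₂ ⊆ Ioi 0 ∩ {r | a < |φ r| ∧ |φ r| < b} := by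
    intro r hr
    have hrR : r ≤ R := hr.2.le.trans hr₂.1.2
    have hr0 : 0 < r := hr₁.1.1.trans_lt hr.1
    refine ⟨hr0, ?_, ?_⟩
    · by_contra! h
      exact (hmin ⟨⟨hr.1.le, hrR⟩, h⟩).not_gt hr.2
    · by_contra! h
      exact (hmax ⟨⟨hr0.le, hrR⟩, h⟩).not_gt hr.1
  have hD : MeasurableSet {r | a < |φ r| ∧ |φ r| < b} :=
    ((isOpen_lt continuous_const hφc.abs).inter (isOpen_lt hφc.abs continuous_const)).measurableSet
  calc ENNReal.ofReal (b - a) ≤ ENNReal.ofReal |φ r₂ - φ r₁| := by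
        refine ENNReal.ofReal_le_ofReal ?_
        have h1 : b ≤ |φ r₁| := hr₁.2
        have h2 : |φ r₂| ≤ a := hr₂.2
        have := abs_sub_abs_le_abs_sub (φ r₁) (φ r₂)
        rw [abs_sub_comm]
        linarith
    _ = ‖∫ r in r₁..r₂, φ' r‖ₑ := by
        rw [intervalIntegral.integral_eq_sub_of_hasDerivAt (fun r _ => hφ r)
          (hc.intervalIntegrable _ _), Real.enorm_eq_ofReal_abs]
    _ ≤ ∫⁻ r in Ioo r₁ r₂, ‖φ' r‖ₑ := by
        rw [intervalIntegral.integral_of_le hr₂.1.1, integral_Ioc_eq_integral_Ioo]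
        exact enorm_integral_le_lintegral_enorm _
    _ ≤ ∫⁻ r in Ioi 0 ∩ {r | a < |φ r| ∧ |φ r| < b}, ‖φ' r‖ₑ := lintegral_mono_set hsub
    _ = _ := by
        rw [inter_comm, setLIntegral_indicator hD]

lemma ofReal_sub_le_lintegral_fderiv {u : ℝ² → ℝ} (hu : ContDiff ℝ (⊤ : ℕ∞) u)
    (hs : HasCompactSupport u) {a b : ℝ} (ha : 0 ≤ a) {x : ℝ²} (hx : b ≤ |u x|) :
    ENNReal.ofReal (2 * π) * ENNReal.ofReal (b - a) ≤
      ∫⁻ y in {y | a < |u y| ∧ |u y| < b}, ‖fderiv ℝ u y‖ₑ * ENNReal.ofReal (‖x - y‖⁻¹) := by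
  set D := {y | a < |u y| ∧ |u y| < b} with hDdef
  have huc := hu.continuous
  have hD : MeasurableSet D :=
    ((isOpen_lt continuous_const huc.abs).inter (isOpen_lt huc.abs continuous_const)).measurableSet
  have hdc : Continuous (fderiv ℝ u) := hu.continuous_fderiv (by simp)
  set g : ℝ² → ℝ≥0∞ := D.indicator fun y => ‖fderiv ℝ u y‖ₑ with hg
  have hgm : Measurable g := (hdc.enorm.measurable).indicator hD
  obtain ⟨R, hR⟩ := hs.isCompact.isBounded.subset_ball x
  have key (θ : sphere (0 : ℝ²) 1) : ENNReal.ofReal (b - a) ≤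
      ∫⁻ r in Ioi (0 : ℝ), ENNReal.ofReal r * (g (x + r • θ.1) * ENNReal.ofReal (‖r • θ.1‖⁻¹)) := by
    have hθ : ‖θ.1‖ = 1 := by simp
    have hder (r : ℝ) : HasDerivAt (fun r : ℝ => u (x + r • θ.1))
        (fderiv ℝ u (x + r • θ.1) θ.1) r := by
      have h1 : HasDerivAt (fun r : ℝ => x + r • θ.1) θ.1 r := by
        simpa using ((hasDerivAt_id r).smul_const θ.1).const_add x
      exact ((hu.differentiable (by simp)) _).hasFDerivAt.comp_hasDerivAt r h1
    have hvan (r : ℝ) (hr : max R 0 ≤ r) : u (x + r • θ.1) = 0 := by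
      by_contra h
      have := hR (subset_tsupport u h)
      rw [mem_ball, dist_eq_norm] at this
      simp only [add_sub_cancel_left, norm_smul, hθ, mul_one, Real.norm_eq_abs] at this
      have h2 := le_abs_self r
      have h3 := le_max_left R 0
      linarith
    refine (ofReal_sub_le_lintegral_deriv hder (by fun_prop) (le_max_right R 0)
      (hvan _ le_rfl) ha (by simpa using hx)).trans ?_
    refine setLIntegral_mono' measurableSet_Ioi fun r (hr : 0 < r) => ?_
    have hrr : ENNReal.ofReal r * (g (x + r • θ.1) * ENNReal.ofReal (‖r • θ.1‖⁻¹)) =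
        g (x + r • θ.1) := by
      rw [mul_left_comm, ← ENNReal.ofReal_mul hr.le, norm_smul, hθ, Real.norm_eq_abs,
        abs_of_pos hr, mul_one, mul_inv_cancel₀ hr.ne', ENNReal.ofReal_one, mul_one]
    rw [hrr, hg]
    by_cases h : x + r • θ.1 ∈ D
    · rw [indicator_of_mem h]
      refine (indicator_le_self _ _ _).trans ?_
      have := (fderiv ℝ u (x + r • θ.1)).le_opNorm θ.1
      rw [hθ, mul_one] at this
      exact enorm_le_iff_norm_le.2 this
    · rw [indicator_of_notMem (by exact h)]
      exact zero_le
  calc ENNReal.ofReal (2 * π) * ENNReal.ofReal (b - a)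
      = ∫⁻ θ : sphere (0 : ℝ²) 1, ENNReal.ofReal (b - a) ∂(volume : Measure ℝ²).toSphere := by
        rw [lintegral_const, toSphere_univ, mul_comm]
    _ ≤ _ := lintegral_mono key
    _ = ∫⁻ z : ℝ², g (x + z) * ENNReal.ofReal (‖z‖⁻¹) :=
        (lintegral_polar (f := fun z => g (x + z) * ENNReal.ofReal (‖z‖⁻¹)) (by fun_prop)).symm
    _ = ∫⁻ y : ℝ², g y * ENNReal.ofReal (‖x - y‖⁻¹) := by
        rw [← lintegral_add_left_eq_self (fun y => g y * ENNReal.ofReal (‖x - y‖⁻¹)) x]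
        simp
    _ = _ := by
        rw [← lintegral_indicator hD]
        refine lintegral_congr fun y => ?_
        by_cases h : y ∈ D <;> simp [hg, h]

lemma sq_lintegral_mul_le {X : Type*} [MeasurableSpace X] {μ : Measure X} {f g : X → ℝ≥0∞}
    (hf : AEMeasurable f μ) (hg : AEMeasurable g μ) :
    (∫⁻ x, f x * g x ∂μ) ^ 2 ≤ (∫⁻ x, f x ^ 2 ∂μ) * ∫⁻ x, g x ^ 2 ∂μ := by
  have h := ENNReal.lintegral_mul_le_Lp_mul_Lq μ Real.HolderConjugate.two_two hf hg
  simp only [Pi.mul_apply, ENNReal.rpow_two] at h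
  refine (pow_le_pow_left' h 2).trans_eq ?_
  rw [mul_pow, ← ENNReal.rpow_two, ← ENNReal.rpow_two, ← ENNReal.rpow_mul, ← ENNReal.rpow_mul]
  norm_num

lemma setLIntegral_sq_riesz_le {E D : Set ℝ²} {r R : ℝ} (hr : 0 < r) (hrR : r ≤ R)
    (hEr : volume E = ENNReal.ofReal (π * r ^ 2)) (hDR : volume D ≤ ENNReal.ofReal (π * R ^ 2)) :
    ∫⁻ y in D, (∫⁻ x in E, ENNReal.ofReal (‖x - y‖⁻¹)) ^ 2 ≤
      ENNReal.ofReal ((π * r ^ 2) ^ 2 * (π * (2 * Real.log (R / r) + 9))) := by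
  have hR : 0 < R := hr.trans_le hrR
  have hlog : 0 ≤ Real.log (R / r) := Real.log_nonneg ((one_le_div hr).2 hrR)
  set kn : ℝ² → ℝ≥0∞ := (ball 0 r).indicator fun z => ENNReal.ofReal (‖z‖⁻¹) with hkn
  set kf : ℝ² → ℝ≥0∞ := (ball 0 r)ᶜ.indicator fun z => ENNReal.ofReal (‖z‖⁻¹) with hkf
  have hkm : Measurable fun z : ℝ² => ENNReal.ofReal (‖z‖⁻¹) := by fun_prop
  have hknm : Measurable kn := hkm.indicator measurableSet_ball
  have hkfm : Measurable kf := hkm.indicator measurableSet_ball.compl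
  have h_int : ∫⁻ z, kn z = ENNReal.ofReal (2 * π * r) := by
    rw [hkn, lintegral_indicator measurableSet_ball]
    have := setLIntegral_radial_rpow (p := 1) (by norm_num) hr
    simp_rw [Real.rpow_neg_one] at this
    rw [this]
    norm_num
  have hkf_le (z : ℝ²) : kf z ≤ ENNReal.ofReal r⁻¹ := by
    by_cases hz : z ∈ ball 0 r
    · simp [hkf, hz]
    · rw [hkf, indicator_of_mem (by exact hz)]
      exact ENNReal.ofReal_le_ofReal (inv_anti₀ hr (by simpa using hz))
  have hkf_sq (z : ℝ²) : kf z ^ 2 ≤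
      {z : ℝ² | ‖z‖ ∈ Ico r R}.indicator (fun z => ENNReal.ofReal ((‖z‖ ^ 2)⁻¹)) z +
        ENNReal.ofReal ((R ^ 2)⁻¹) := by
    by_cases h1 : z ∈ ball 0 r
    · simp [hkf, h1]
    · rw [hkf, indicator_of_mem (by exact h1), ← ENNReal.ofReal_pow (by positivity), inv_pow]
      have h2 : r ≤ ‖z‖ := by simpa using h1
      rcases lt_or_ge ‖z‖ R with h3 | h3
      · rw [indicator_of_mem (by exact ⟨h2, h3⟩)]
        exact le_self_add
      · refine le_add_left (ENNReal.ofReal_le_ofReal ?_)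
        gcongr
  set N : ℝ² → ℝ≥0∞ := fun y => ∫⁻ x in E, kn (x - y) with hN
  set F : ℝ² → ℝ≥0∞ := fun y => ∫⁻ x in E, kf (x - y) with hF
  have hNm : Measurable N :=
    (show Measurable fun p : ℝ² × ℝ² => kn (p.2 - p.1) by fun_prop).lintegral_prod_right'
  have hFm : Measurable F :=
    (show Measurable fun p : ℝ² × ℝ² => kf (p.2 - p.1) by fun_prop).lintegral_prod_right'
  have hP (y : ℝ²) : ∫⁻ x in E, ENNReal.ofReal (‖x - y‖⁻¹) = N y + F y := by
    rw [hN, hF, ← lintegral_add_left (by fun_prop)]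
    refine lintegral_congr fun x => ?_
    rw [hkn, hkf, ← Pi.add_apply, indicator_self_add_compl]
  have hN_le (y : ℝ²) : N y ≤ ENNReal.ofReal (2 * π * r) := by
    rw [← h_int, ← lintegral_sub_right_eq_self kn y]
    exact setLIntegral_le_lintegral _ _
  have hF_le (y : ℝ²) : F y ≤ ENNReal.ofReal (π * r) := by
    refine (lintegral_mono fun x => hkf_le (x - y)).trans ?_
    rw [setLIntegral_const, hEr, ← ENNReal.ofReal_mul (by positivity)]
    refine ENNReal.ofReal_le_ofReal (le_of_eq ?_)
    field_simp
  have hN_int : ∫⁻ y in D, N y ≤ ENNReal.ofReal (2 * π * r) * ENNReal.ofReal (π * r ^ 2) := by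
    rw [hN, lintegral_lintegral_swap (by fun_prop)]
    refine (lintegral_mono fun x => (?_ : _ ≤ ENNReal.ofReal (2 * π * r))).trans_eq ?_
    · rw [← h_int, ← lintegral_sub_left_eq_self kn x]
      exact setLIntegral_le_lintegral _ _
    · rw [setLIntegral_const, hEr]
  have hF_sq (y : ℝ²) : F y ^ 2 ≤ ENNReal.ofReal (π * r ^ 2) * ∫⁻ x in E, kf (x - y) ^ 2 := by
    have := sq_lintegral_mul_le (μ := volume.restrict E) (f := fun _ => 1)
      (g := fun x => kf (x - y)) (by fun_prop) (by fun_prop)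
    simpa [hEr] using this
  have hF_int : ∫⁻ y in D, F y ^ 2 ≤ ENNReal.ofReal (π * r ^ 2) *
      (ENNReal.ofReal (2 * π * Real.log (R / r) + π) * ENNReal.ofReal (π * r ^ 2)) := by
    refine (lintegral_mono hF_sq).trans ?_
    rw [lintegral_const_mul' _ _ ENNReal.ofReal_ne_top]
    gcongr
    rw [lintegral_lintegral_swap (by fun_prop)]
    refine (lintegral_mono fun x =>
      (?_ : _ ≤ ENNReal.ofReal (2 * π * Real.log (R / r) + π))).trans_eq ?_
    · have hA : MeasurableSet {z : ℝ² | ‖z‖ ∈ Ico r R} := measurable_norm measurableSet_Ico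
      refine (lintegral_mono fun y => hkf_sq (x - y)).trans ?_
      rw [lintegral_add_right _ measurable_const, setLIntegral_const,
        ENNReal.ofReal_add (by positivity) pi_pos.le]
      gcongr
      · rw [← setLIntegral_annulus hr hrR, ← lintegral_indicator hA,
          ← lintegral_sub_left_eq_self (μ := volume) _ x]
        exact setLIntegral_le_lintegral _ _
      · refine (mul_le_mul_right hDR _).trans_eq ?_
        rw [← ENNReal.ofReal_mul (by positivity)]
        congr 1
        field_simp
    · rw [setLIntegral_const, hEr]
  calc ∫⁻ y in D, (∫⁻ x in E, ENNReal.ofReal (‖x - y‖⁻¹)) ^ 2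
      ≤ ∫⁻ y in D, (ENNReal.ofReal (4 * π * r) * N y + F y ^ 2) := by
        refine lintegral_mono fun y => ?_
        rw [hP, show (N y + F y) ^ 2 = (N y + 2 * F y) * N y + F y ^ 2 by ring]
        gcongr
        calc N y + 2 * F y ≤ ENNReal.ofReal (2 * π * r) + 2 * ENNReal.ofReal (π * r) := by
              gcongr <;> [exact hN_le y; exact hF_le y]
          _ = _ := by
              rw [← ENNReal.ofReal_ofNat, ← ENNReal.ofReal_mul (by norm_num),
                ← ENNReal.ofReal_add (by positivity) (by positivity)]
              congr 1; ring
    _ = ENNReal.ofReal (4 * π * r) * (∫⁻ y in D, N y) + ∫⁻ y in D, F y ^ 2 := by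
        rw [lintegral_add_left (by fun_prop), lintegral_const_mul _ hNm]
    _ ≤ ENNReal.ofReal (4 * π * r) * (ENNReal.ofReal (2 * π * r) * ENNReal.ofReal (π * r ^ 2)) +
        ENNReal.ofReal (π * r ^ 2) *
        (ENNReal.ofReal (2 * π * Real.log (R / r) + π) * ENNReal.ofReal (π * r ^ 2)) := by
        gcongr
    _ = _ := by
        rw [← ENNReal.ofReal_mul (by positivity), ← ENNReal.ofReal_mul (by positivity),
          ← ENNReal.ofReal_mul (by positivity), ← ENNReal.ofReal_mul (by positivity),
          ← ENNReal.ofReal_add (by positivity) (by positivity)]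
        congr 1; ring

lemma sq_sub_le_energy {u : ℝ² → ℝ} (hu : ContDiff ℝ (⊤ : ℕ∞) u)
    (hs : HasCompactSupport u) {a b e M : ℝ} (ha : 0 ≤ a) (hab : a ≤ b) (he : 0 ≤ e)
    (hen : ∫⁻ y in {y | a < |u y| ∧ |u y| < b}, ‖fderiv ℝ u y‖ₑ ^ 2 ≤ ENNReal.ofReal e)
    (hm : 0 < volume.real {x | b ≤ |u x|}) (hmM : volume.real {x | b ≤ |u x|} ≤ M)
    (hfin : volume {x | b ≤ |u x|} ≠ ⊤)
    (hM : volume {x | a < |u x| ∧ |u x| < b} ≤ ENNReal.ofReal M) :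
    4 * π * (b - a) ^ 2 ≤ e * (Real.log (M / volume.real {x | b ≤ |u x|}) + 9) := by
  set D := {y | a < |u y| ∧ |u y| < b} with hDdef
  set E := {x | b ≤ |u x|} with hEdef
  set m := volume.real E with hmdef
  have huc := hu.continuous
  have hdc : Continuous (fderiv ℝ u) := hu.continuous_fderiv (by simp)
  have hD : MeasurableSet D :=
    ((isOpen_lt continuous_const huc.abs).inter (isOpen_lt huc.abs continuous_const)).measurableSet
  have hE : MeasurableSet E := (isClosed_le continuous_const huc.abs).measurableSet
  have hM0 : 0 < M := hm.trans_le hmM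
  set r := √(m / π) with hr
  set R := √(M / π) with hR
  have hr2 : π * r ^ 2 = m := by rw [hr, Real.sq_sqrt (by positivity)]; field_simp
  have hR2 : π * R ^ 2 = M := by rw [hR, Real.sq_sqrt (by positivity)]; field_simp
  have hr0 : 0 < r := by rw [hr]; positivity
  have hrR : r ≤ R := Real.sqrt_le_sqrt (by gcongr)
  have hvE : volume E = ENNReal.ofReal m := (ENNReal.ofReal_toReal hfin).symm
  have hker := setLIntegral_sq_riesz_le hr0 hrR (by rw [hr2, hvE]) (by rwa [hR2])
  have hlog : 2 * Real.log (R / r) = Real.log (M / m) := by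
    rw [← hr2, ← hR2, mul_div_mul_left _ _ pi_pos.ne', ← div_pow, Real.log_pow]
    norm_num
  rw [hr2, hlog] at hker
  have hlog0 : 0 ≤ Real.log (M / m) := Real.log_nonneg ((one_le_div hm).2 hmM)
  have hmain : ENNReal.ofReal (2 * π) * ENNReal.ofReal (b - a) * ENNReal.ofReal m ≤
      ∫⁻ y in D, ‖fderiv ℝ u y‖ₑ * ∫⁻ x in E, ENNReal.ofReal (‖x - y‖⁻¹) := by
    calc ENNReal.ofReal (2 * π) * ENNReal.ofReal (b - a) * ENNReal.ofReal m
        = ∫⁻ x in E, ENNReal.ofReal (2 * π) * ENNReal.ofReal (b - a) := by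
          rw [setLIntegral_const, hvE]
      _ ≤ ∫⁻ x in E, ∫⁻ y in D, ‖fderiv ℝ u y‖ₑ * ENNReal.ofReal (‖x - y‖⁻¹) :=
          setLIntegral_mono' hE fun x hx => ofReal_sub_le_lintegral_fderiv hu hs ha hx
      _ = ∫⁻ y in D, ∫⁻ x in E, ‖fderiv ℝ u y‖ₑ * ENNReal.ofReal (‖x - y‖⁻¹) := by
          refine lintegral_lintegral_swap (Measurable.aemeasurable ?_)
          have := hdc.enorm.measurable
          fun_prop
      _ = _ := by
          refine lintegral_congr fun y => ?_
          rw [lintegral_const_mul _ (by fun_prop)]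
  have hPm : Measurable fun y : ℝ² => ∫⁻ x in E, ENNReal.ofReal (‖x - y‖⁻¹) :=
    (show Measurable fun p : ℝ² × ℝ² => ENNReal.ofReal (‖p.2 - p.1‖⁻¹) by
      fun_prop).lintegral_prod_right'
  have hsq := (pow_le_pow_left' hmain 2).trans
    ((sq_lintegral_mul_le hdc.enorm.measurable.aemeasurable hPm.aemeasurable).trans
      (mul_le_mul' hen hker))
  rw [← ENNReal.ofReal_mul (by positivity), ← ENNReal.ofReal_mul (by
    have := sub_nonneg.2 hab; positivity), ← ENNReal.ofReal_pow (by
    have := sub_nonneg.2 hab; positivity), ← ENNReal.ofReal_mul he,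
    ENNReal.ofReal_le_ofReal_iff (by positivity)] at hsq
  have hpos : 0 < π * m ^ 2 := by positivity
  refine le_of_mul_le_mul_left ?_ hpos
  linarith

lemma sq_sub_sq_le_of_energy {a b p q e₁ e₂ L : ℝ} (ha : 0 ≤ a) (hab : a ≤ b) (hL : 0 < L)
    (haL : L ≤ a ^ 2) (he₂ : 0 ≤ e₂) (he : e₁ + e₂ ≤ 1) (hpL : p ≤ a ^ 2 + L)
    (hq : q ≤ b ^ 2 - p + L) (hp : 0 ≤ p) (h₁ : a ^ 2 ≤ e₁ * p) (h₂ : (b - a) ^ 2 ≤ e₂ * q) :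
    b ^ 2 - a ^ 2 ≤ 12 * L := by
  set d := b - a with hd
  have hd0 : 0 ≤ d := sub_nonneg.2 hab
  have hb : b = a + d := by ring
  have hpa : a ^ 2 ≤ p := by nlinarith
  have hp0 : 0 < p := by linarith
  have hq' : q ≤ 2 * a * d + d ^ 2 + L := by rw [hb] at hq; nlinarith
  have hQ : 0 ≤ 2 * a * d + d ^ 2 + L := by positivity
  have h3 : d ^ 2 ≤ e₂ * (2 * a * d + d ^ 2 + L) := h₂.trans (by gcongr)
  have h4 : e₂ * (a ^ 2 + L) ≤ L := by
    have h5 : e₂ * p ≤ p - a ^ 2 := by nlinarith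
    have h6 : e₂ ≤ 1 - a ^ 2 / p := by
      rw [le_sub_iff_add_le, ← sub_nonneg]
      have : 0 ≤ (p - a ^ 2 - e₂ * p) / p := div_nonneg (by linarith) hp0.le
      convert this using 1
      field_simp
      ring
    have h7 : a ^ 2 / (a ^ 2 + L) ≤ a ^ 2 / p := by gcongr
    have h8 : (a ^ 2 / (a ^ 2 + L)) * (a ^ 2 + L) = a ^ 2 := by field_simp
    have h9 : e₂ ≤ 1 - a ^ 2 / (a ^ 2 + L) := by linarith
    nlinarith [mul_le_mul_of_nonneg_right h9 (show 0 ≤ a ^ 2 + L by positivity)]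
  have h5 : d ^ 2 * (a ^ 2 + L) ≤ L * (2 * a * d + d ^ 2 + L) := by
    calc d ^ 2 * (a ^ 2 + L) ≤ e₂ * (2 * a * d + d ^ 2 + L) * (a ^ 2 + L) := by gcongr
      _ = e₂ * (a ^ 2 + L) * (2 * a * d + d ^ 2 + L) := by ring
      _ ≤ _ := by gcongr
  have h6 : (a * d - L) ^ 2 ≤ (3 / 2 * L) ^ 2 := by nlinarith
  have h7 : a * d ≤ 5 / 2 * L := by
    have := abs_le_of_sq_le_sq h6 (by positivity)
    linarith [le_abs_self (a * d - L)]
  have h8 : d ^ 2 ≤ 25 / 4 * L := by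
    have : d ^ 2 * L ≤ (25 / 4 * L) * L := by
      calc d ^ 2 * L ≤ d ^ 2 * a ^ 2 := by gcongr
        _ = (a * d) ^ 2 := by ring
        _ ≤ (5 / 2 * L) ^ 2 := by gcongr
        _ = _ := by ring
    exact le_of_mul_le_mul_right this hL
  rw [hb]
  nlinarith

lemma volume_le_of_forall_sub_le {S : Set ℝ} {L K : ℝ} (hL : 0 ≤ L) (hK : 0 ≤ K) (hS : S ⊆ Ioi 0)
    (h : ∀ x ∈ S, ∀ y ∈ S, L ≤ x → x ≤ y → y - x ≤ K) : volume S ≤ ENNReal.ofReal (L + K) := by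
  have hsub : S ⊆ Ioc 0 L ∪ (S ∩ Ioi L) := fun x hx => by
    rcases le_or_gt x L with h1 | h1
    · exact Or.inl ⟨hS hx, h1⟩
    · exact Or.inr ⟨hx, h1⟩
  refine (measure_mono hsub).trans ((measure_union_le _ _).trans ?_)
  rw [ENNReal.ofReal_add hL hK, Real.volume_Ioc, sub_zero]
  gcongr
  refine (Real.volume_le_diam _).trans (Metric.ediam_le fun x hx y hy => ?_)
  rw [edist_dist, Real.dist_eq]
  refine ENNReal.ofReal_le_ofReal (abs_le.2 ?_)
  rcases le_total x y with hxy | hxy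
  · have := h x hx.1 y hy.1 (le_of_lt hx.2) hxy
    constructor <;> linarith
  · have := h y hy.1 x hx.1 (le_of_lt hy.2) hxy
    constructor <;> linarith

lemma setLIntegral_norm_rpow_le {β : ℝ} (hβ0 : 0 ≤ β) (hβ2 : β < 2) {A : Set ℝ²}
    (hA : volume A ≠ ⊤) :
    ∫⁻ x in A, ENNReal.ofReal (‖x‖ ^ (-β)) ≤
      ENNReal.ofReal ((2 * π / (2 - β) + π) / π ^ (1 - β / 2) *
        volume.real A ^ (1 - β / 2)) := by
  rcases (measureReal_nonneg (μ := volume) (s := A)).eq_or_lt' with h0 | h0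
  · have : volume A = 0 := (measureReal_eq_zero_iff hA).1 h0
    rw [setLIntegral_measure_zero _ _ this]
    exact zero_le
  set m := volume.real A with hm
  set r := √(m / π) with hr
  have hr0 : 0 < r := by rw [hr]; positivity
  have hr2 : r ^ 2 * π = m := by rw [hr, Real.sq_sqrt (by positivity)]; field_simp
  have hβ : 0 < 2 - β := by linarith
  have hpow : r ^ (2 - β) = m ^ (1 - β / 2) / π ^ (1 - β / 2) := by
    rw [hr, Real.sqrt_eq_rpow, ← Real.rpow_mul (by positivity), Real.div_rpow h0.le pi_pos.le]
    congr 2 <;> ring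
  have hpt (x : ℝ²) : ENNReal.ofReal (‖x‖ ^ (-β)) ≤
      (ball 0 r).indicator (fun x => ENNReal.ofReal (‖x‖ ^ (-β))) x +
        ENNReal.ofReal (r ^ (-β)) := by
    by_cases hx : x ∈ ball 0 r
    · rw [indicator_of_mem hx]; exact le_self_add
    · refine le_add_left (ENNReal.ofReal_le_ofReal ?_)
      exact Real.rpow_le_rpow_of_nonpos hr0 (by simpa using hx) (by linarith)
  calc ∫⁻ x in A, ENNReal.ofReal (‖x‖ ^ (-β))
      ≤ ∫⁻ x in A, ((ball 0 r).indicator (fun x => ENNReal.ofReal (‖x‖ ^ (-β))) x +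
        ENNReal.ofReal (r ^ (-β))) := lintegral_mono hpt
    _ = (∫⁻ x in A, (ball 0 r).indicator (fun x => ENNReal.ofReal (‖x‖ ^ (-β))) x) +
        ENNReal.ofReal (r ^ (-β)) * ENNReal.ofReal m := by
        rw [lintegral_add_right _ measurable_const, setLIntegral_const, hm, measureReal_def,
          ENNReal.ofReal_toReal hA]
    _ ≤ ENNReal.ofReal (2 * π / (2 - β) * r ^ (2 - β)) +
        ENNReal.ofReal (r ^ (-β)) * ENNReal.ofReal m := by
        gcongr
        rw [← setLIntegral_radial_rpow hβ2 hr0, ← lintegral_indicator measurableSet_ball]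
        exact setLIntegral_le_lintegral _ _
    _ = _ := by
        rw [← ENNReal.ofReal_mul (by positivity), ← ENNReal.ofReal_add (by positivity)
          (by positivity)]
        congr 1
        have : r ^ (-β) * m = π * r ^ (2 - β) := by
          rw [← hr2, show (2 : ℝ) - β = -β + (2 : ℕ) by push_cast; ring,
            Real.rpow_add_natCast hr0.ne']
          ring
        rw [this, hpow]
        field_simp

/-- Superlevel sets of `4 * π * u ^ 2`, for `u` in the unit ball of the Dirichlet norm. The
function `x - log (M / m x)`, where `m x` is the area of the `x`-superlevel set, is at most `9`, and
it stays above `8 - n` only on a set whose length is linear in `n`. -/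
lemma level_set_estimate {u : ℝ² → ℝ} (hu : ContDiff ℝ (⊤ : ℕ∞) u)
    (hs : HasCompactSupport u) (hen : ∫⁻ y, ‖fderiv ℝ u y‖ₑ ^ 2 ≤ 1) {M : ℝ}
    (hM : volume (Function.support u) ≤ ENNReal.ofReal M) {m : ℝ → ℝ}
    (hm : ∀ x, m x = volume.real {y | x ≤ 4 * π * u y ^ 2}) :
    (∀ x, 0 < x → 0 < m x → x - Real.log (M / m x) ≤ 9) ∧
      ∀ n : ℕ, volume {x | 0 < x ∧ 0 < m x ∧ 8 - n ≤ x - Real.log (M / m x)} ≤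
        ENNReal.ofReal (13 * (n + 10)) := by
  have hset (x : ℝ) : {y | x ≤ 4 * π * u y ^ 2} = {y | √(x / (4 * π)) ≤ |u y|} := by
    ext y
    simp only [mem_ofPred_eq]
    rw [Real.sqrt_le_iff, sq_abs, div_le_iff₀ (by positivity), mul_comm]
    simp
  have hsupp (x : ℝ) (hx : 0 < x) : {y | √(x / (4 * π)) ≤ |u y|} ⊆ Function.support u := by
    intro y hy h
    have : 0 < √(x / (4 * π)) := by positivity
    simp only [mem_ofPred_eq, h, abs_zero] at hy
    linarith
  have hfin (x : ℝ) (hx : 0 < x) : volume {y | √(x / (4 * π)) ≤ |u y|} ≠ ⊤ :=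
    ((measure_mono (hsupp x hx)).trans hM).trans_lt ENNReal.ofReal_lt_top |>.ne
  have hm' (x : ℝ) : m x = volume.real {y | √(x / (4 * π)) ≤ |u y|} := by rw [hm, hset]
  have huc := hu.continuous
  have hmeas (a b : ℝ) : MeasurableSet {y | a < |u y| ∧ |u y| < b} :=
    ((isOpen_lt continuous_const huc.abs).inter (isOpen_lt huc.abs continuous_const)).measurableSet
  set e : ℝ → ℝ → ℝ := fun a b =>
    (∫⁻ y in {y | a < |u y| ∧ |u y| < b}, ‖fderiv ℝ u y‖ₑ ^ 2).toReal with he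
  have hlt (a b : ℝ) : ∫⁻ y in {y | a < |u y| ∧ |u y| < b}, ‖fderiv ℝ u y‖ₑ ^ 2 ≠ ⊤ :=
    ((setLIntegral_le_lintegral _ _).trans hen).trans_lt ENNReal.one_lt_top |>.ne
  have hadd (a b : ℝ) : e 0 a + e a b ≤ 1 := by
    rw [he]
    simp only
    rw [← ENNReal.toReal_add (hlt _ _) (hlt _ _), ← lintegral_union (hmeas _ _)
      (Set.disjoint_left.2 fun y hy hy' => lt_asymm hy.2 hy'.1)]
    exact ENNReal.toReal_le_of_le_ofReal zero_le_one
      ((setLIntegral_le_lintegral _ _).trans (hen.trans_eq ENNReal.ofReal_one.symm))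
  have he0 (a b : ℝ) : 0 ≤ e a b := ENNReal.toReal_nonneg
  have hsq (x : ℝ) (hx : 0 < x) : 4 * π * √(x / (4 * π)) ^ 2 = x := by
    rw [Real.sq_sqrt (by positivity)]; field_simp
  have hmM (x : ℝ) (hx : 0 < x) (hmx : 0 < m x) : m x ≤ M := by
    have h1 := (measure_mono (μ := volume) (hsupp x hx)).trans hM
    have h2 : m x ≤ (ENNReal.ofReal M).toReal := by
      rw [hm']; exact ENNReal.toReal_mono ENNReal.ofReal_ne_top h1
    rw [ENNReal.toReal_ofReal'] at h2
    rcases le_max_iff.1 h2 with h | h <;> linarith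
  have hone (x : ℝ) (hx : 0 < x) (hmx : 0 < m x) :
      x ≤ e 0 √(x / (4 * π)) * (Real.log (M / m x) + 9) := by
    have hM' : volume {y | 0 < |u y| ∧ |u y| < √(x / (4 * π))} ≤ ENNReal.ofReal M :=
      (measure_mono fun y hy => abs_pos.1 hy.1).trans hM
    have := sq_sub_le_energy hu hs le_rfl (Real.sqrt_nonneg _) (he0 _ _)
      (ENNReal.ofReal_toReal (hlt _ _)).ge (by rwa [← hm']) (by rw [← hm']; exact hmM x hx hmx)
      (hfin x hx) hM'
    rwa [sub_zero, hsq x hx, ← hm'] at this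
  have htwo (x y : ℝ) (hx : 0 < x) (hxy : x ≤ y) (hmx : 0 < m x) (hmy : 0 < m y) :
      4 * π * (√(y / (4 * π)) - √(x / (4 * π))) ^ 2 ≤ e √(x / (4 * π)) √(y / (4 * π)) *
        (Real.log (m x / m y) + 9) := by
    have hy := hx.trans_le hxy
    have hle : √(x / (4 * π)) ≤ √(y / (4 * π)) := Real.sqrt_le_sqrt (by gcongr)
    have hM' : volume {z | √(x / (4 * π)) < |u z| ∧ |u z| < √(y / (4 * π))} ≤
        ENNReal.ofReal (m x) := by
      rw [hm', measureReal_def, ENNReal.ofReal_toReal (hfin x hx)]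
      exact measure_mono fun z hz => hz.1.le
    have hmono : m y ≤ m x := by
      rw [hm', hm']
      exact measureReal_mono (fun z (hz : _ ≤ _) => hle.trans hz) (hfin x hx)
    have := sq_sub_le_energy hu hs (Real.sqrt_nonneg _) hle (he0 _ _)
      (ENNReal.ofReal_toReal (hlt _ _)).ge (by rwa [← hm']) (by rwa [← hm'])
      (hfin y hy) hM'
    rwa [← hm'] at this
  have hlog (x : ℝ) (hx : 0 < x) (hmx : 0 < m x) : 0 ≤ Real.log (M / m x) :=
    Real.log_nonneg ((one_le_div hmx).2 (hmM x hx hmx))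
  have hbound (x : ℝ) (hx : 0 < x) (hmx : 0 < m x) : x ≤ Real.log (M / m x) + 9 := by
    have h1 := hone x hx hmx
    have h2 := hlog x hx hmx
    have h3 : e 0 √(x / (4 * π)) ≤ 1 := by linarith [hadd √(x / (4 * π)) 0, he0 √(x / (4 * π)) 0]
    nlinarith
  refine ⟨fun x hx hmx => by linarith [hbound x hx hmx], fun n => ?_⟩
  have hn : (0 : ℝ) ≤ n := Nat.cast_nonneg n
  rw [show (13 : ℝ) * (n + 10) = (n + 10) + 12 * (n + 10) by ring]
  refine volume_le_of_forall_sub_le (by positivity) (by positivity) (fun x hx => hx.1) ?_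
  rintro x ⟨hx, hmx, hgx⟩ y ⟨hy, hmy, hgy⟩ hLx hxy
  have hMx := hlog x hx hmx
  have hpos : 0 < M := hmx.trans_le (hmM x hx hmx)
  have hsub : Real.log (m x / m y) = Real.log (M / m y) - Real.log (M / m x) := by
    rw [Real.log_div hmx.ne' hmy.ne', Real.log_div hpos.ne' hmy.ne', Real.log_div hpos.ne' hmx.ne']
    ring
  have h2 := htwo x y hx hxy hmx hmy
  have h3 : (√y - √x) ^ 2 = 4 * π * (√(y / (4 * π)) - √(x / (4 * π))) ^ 2 := by
    rw [Real.sqrt_div hx.le, Real.sqrt_div hy.le, ← sub_div, div_pow, Real.sq_sqrt (by positivity)]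
    field_simp
  have := sq_sub_sq_le_of_energy (a := √x) (b := √y) (p := Real.log (M / m x) + 9)
    (q := Real.log (m x / m y) + 9) (e₁ := e 0 √(x / (4 * π)))
    (e₂ := e √(x / (4 * π)) √(y / (4 * π))) (L := n + 10) (Real.sqrt_nonneg _)
    (Real.sqrt_le_sqrt hxy) (by positivity) (by rwa [Real.sq_sqrt hx.le]) (he0 _ _) (hadd _ _)
    (by rw [Real.sq_sqrt hx.le]; linarith) (by rw [Real.sq_sqrt hy.le]; linarith)
    (by linarith) (by rw [Real.sq_sqrt hx.le]; exact hone x hx hmx) (by rw [h3]; exact h2)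
  rwa [Real.sq_sqrt hx.le, Real.sq_sqrt hy.le] at this

lemma lintegral_enorm_fderiv_sq_le_one {u : ℝ² → ℝ} (hu : ContDiff ℝ (⊤ : ℕ∞) u)
    (hs : HasCompactSupport u) (hen : ∫ x, ‖fderiv ℝ u x‖ ^ 2 ≤ 1) :
    ∫⁻ y, ‖fderiv ℝ u y‖ₑ ^ 2 ≤ 1 := by
  have hdc : Continuous (fderiv ℝ u) := hu.continuous_fderiv (by simp)
  have hcs : HasCompactSupport fun x => ‖fderiv ℝ u x‖ ^ 2 :=
    (hs.fderiv ℝ).comp_left (g := fun L => ‖L‖ ^ 2) (by simp)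
  have h_int : Integrable fun x => ‖fderiv ℝ u x‖ ^ 2 :=
    (hdc.norm.pow 2).integrable_of_hasCompactSupport hcs
  have := ofReal_integral_eq_lintegral_ofReal h_int (ae_of_all _ fun x => by positivity)
  calc ∫⁻ y, ‖fderiv ℝ u y‖ₑ ^ 2 = ∫⁻ y, ENNReal.ofReal (‖fderiv ℝ u y‖ ^ 2) := by
        refine lintegral_congr fun y => ?_
        rw [ENNReal.ofReal_pow (norm_nonneg _), ofReal_norm]
    _ ≤ 1 := by
        rw [← this]
        exact (ENNReal.ofReal_le_ofReal hen).trans_eq ENNReal.ofReal_one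

lemma summable_natCast_add_mul_exp {γ : ℝ} (hγ : 0 < γ) :
    Summable fun n : ℕ => ((n : ℝ) + 10) * rexp (-γ * n) := by
  have h1 := Real.summable_pow_mul_exp_neg_nat_mul 1 hγ
  have h0 := Real.summable_pow_mul_exp_neg_nat_mul 0 hγ
  refine (h1.add (h0.mul_left 10)).congr fun n => ?_
  ring

/-- A layer-by-layer bound for `∫ m(x) ^ γ e ^ (γ x) dx` from bounds on the function
`x - log (M / m x)`. -/
lemma lintegral_level_le {m : ℝ → ℝ} {M γ : ℝ} (hM : 0 < M) (hγ : 0 < γ)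
    (hm0 : ∀ x, 0 ≤ m x)
    (hle : ∀ x, 0 < x → 0 < m x → x - Real.log (M / m x) ≤ 9)
    (hvol : ∀ n : ℕ, volume {x | 0 < x ∧ 0 < m x ∧ 8 - n ≤ x - Real.log (M / m x)} ≤
      ENNReal.ofReal (13 * (n + 10))) :
    ∫⁻ x in Ioi 0, ENNReal.ofReal (m x ^ γ * rexp (γ * x)) ≤
      ENNReal.ofReal (∑' n : ℕ, 13 * M ^ γ * rexp (9 * γ) * (((n : ℝ) + 10) * rexp (-γ * n))) := by
  set S : ℕ → Set ℝ := fun n =>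
    toMeasurable volume {x | 0 < x ∧ 0 < m x ∧ 8 - n ≤ x - Real.log (M / m x)} with hS
  set c : ℕ → ℝ≥0∞ := fun n => ENNReal.ofReal (M ^ γ * rexp (9 * γ) * rexp (-γ * n)) with hc
  have hpt (x : ℝ) (hx : 0 < x) : ENNReal.ofReal (m x ^ γ * rexp (γ * x)) ≤
      ∑' n, (S n).indicator (fun _ => c n) x := by
    rcases (hm0 x).eq_or_lt' with h0 | h0
    · rw [h0, Real.zero_rpow hγ.ne']
      simp
    set g := x - Real.log (M / m x) with hg
    have hg9 : 0 ≤ 9 - g := by linarith [hle x hx h0]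
    set n := ⌊9 - g⌋₊ with hn
    have h1 : (n : ℝ) ≤ 9 - g := Nat.floor_le hg9
    have h2 : 9 - g < n + 1 := Nat.lt_floor_add_one _
    have hmem : x ∈ S n := subset_toMeasurable _ _ ⟨hx, h0, by linarith⟩
    refine le_trans ?_ (ENNReal.le_tsum n)
    rw [indicator_of_mem hmem, hc]
    refine ENNReal.ofReal_le_ofReal ?_
    have h3 : m x = M * rexp (g - x) := by
      rw [hg, show x - Real.log (M / m x) - x = -Real.log (M / m x) by ring, Real.exp_neg,
        Real.exp_log (by positivity)]
      field_simp
    rw [h3, Real.mul_rpow hM.le (Real.exp_pos _).le, ← Real.exp_mul, mul_assoc, mul_assoc,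
      ← Real.exp_add, ← Real.exp_add]
    refine mul_le_mul_of_nonneg_left (Real.exp_le_exp.2 ?_) (by positivity)
    nlinarith [mul_nonneg hγ.le (sub_nonneg.2 h1)]
  calc ∫⁻ x in Ioi 0, ENNReal.ofReal (m x ^ γ * rexp (γ * x))
      ≤ ∫⁻ x in Ioi 0, ∑' n, (S n).indicator (fun _ => c n) x :=
        setLIntegral_mono' measurableSet_Ioi hpt
    _ ≤ ∫⁻ x, ∑' n, (S n).indicator (fun _ => c n) x := setLIntegral_le_lintegral _ _
    _ = ∑' n, ∫⁻ x, (S n).indicator (fun _ => c n) x :=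
        lintegral_tsum fun n =>
          (measurable_const.indicator (measurableSet_toMeasurable _ _)).aemeasurable
    _ ≤ ∑' n : ℕ, ENNReal.ofReal
          (13 * M ^ γ * rexp (9 * γ) * (((n : ℝ) + 10) * rexp (-γ * n))) := by
        refine ENNReal.tsum_le_tsum fun n => ?_
        rw [lintegral_indicator_const (measurableSet_toMeasurable _ _), measure_toMeasurable]
        refine (mul_le_mul_right (hvol n) _).trans_eq ?_
        rw [hc, ← ENNReal.ofReal_mul (by positivity)]
        congr 1
        ring
    _ = _ := (ENNReal.ofReal_tsum_of_nonneg (fun n => by positivity)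
        ((summable_natCast_add_mul_exp hγ).mul_left _)).symm

lemma exists_bound_critical {Ω : Set ℝ²} (hΩo : IsOpen Ω) (hΩb : Bornology.IsBounded Ω)
    (h0 : (0 : ℝ²) ∈ Ω) {β : ℝ} (hβ0 : 0 ≤ β) (hβ2 : β < 2) :
    ∃ C : ℝ≥0∞, C < ⊤ ∧ ∀ u : ℝ² → ℝ, ContDiff ℝ (⊤ : ℕ∞) u → tsupport u ⊆ Ω →
      (∫ x, ‖fderiv ℝ u x‖ ^ 2) ≤ 1 →
      ∫⁻ x in Ω, ENNReal.ofReal (rexp ((1 - β / 2) * (4 * π * u x ^ 2)) / ‖x‖ ^ β) ≤ C := by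
  set γ := 1 - β / 2 with hγdef
  have hγ : 0 < γ := by linarith
  have hβ : 0 < 2 - β := by linarith
  have hvΩ : volume Ω ≠ ⊤ := hΩb.measure_lt_top.ne
  set M := volume.real Ω with hMdef
  have hM : 0 < M := ENNReal.toReal_pos (hΩo.measure_pos volume ⟨0, h0⟩).ne' hvΩ
  have hMo : volume Ω = ENNReal.ofReal M := (ENNReal.ofReal_toReal hvΩ).symm
  set K := (2 * π / (2 - β) + π) / π ^ γ with hK
  have hK0 : 0 ≤ K := by positivity
  refine ⟨ENNReal.ofReal (K * M ^ γ) + ENNReal.ofReal (K * γ) * ENNReal.ofReal (∑' n : ℕ,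
    13 * M ^ γ * rexp (9 * γ) * (((n : ℝ) + 10) * rexp (-γ * n))), ?_, fun u hu hsΩ hen => ?_⟩
  · exact ENNReal.add_lt_top.2 ⟨ENNReal.ofReal_lt_top,
      ENNReal.mul_lt_top ENNReal.ofReal_lt_top ENNReal.ofReal_lt_top⟩
  have hs : HasCompactSupport u :=
    Metric.isCompact_of_isClosed_isBounded (isClosed_tsupport u) (hΩb.subset hsΩ)
  have hsupp : Function.support u ⊆ Ω := (subset_tsupport u).trans hsΩ
  have hum : Measurable u := hu.continuous.measurable
  set m : ℝ → ℝ := fun x => volume.real {y | x ≤ 4 * π * u y ^ 2} with hm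
  obtain ⟨hle, hvol⟩ := level_set_estimate hu hs (lintegral_enorm_fderiv_sq_le_one hu hs hen)
    ((measure_mono hsupp).trans_eq hMo) (m := m) fun x => rfl
  set w : ℝ² → ℝ≥0∞ := fun x => ENNReal.ofReal (‖x‖ ^ (-β)) with hw
  have hwm : Measurable w := by fun_prop
  set ν := (volume.restrict Ω).withDensity w with hν
  have hνuniv : ν univ ≤ ENNReal.ofReal (K * M ^ γ) := by
    rw [hν, withDensity_apply _ MeasurableSet.univ, Measure.restrict_univ]
    exact setLIntegral_norm_rpow_le hβ0 hβ2 hvΩ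
  have hνlevel (t : ℝ) (ht : 0 < t) : ν {y | t ≤ 4 * π * u y ^ 2} ≤
      ENNReal.ofReal (K * m t ^ γ) := by
    have hsub : {y | t ≤ 4 * π * u y ^ 2} ⊆ Ω := fun y hy => hsupp fun h => by
      simp only [mem_ofPred_eq, h] at hy
      norm_num at hy
      linarith
    have hmeas : MeasurableSet {y | t ≤ 4 * π * u y ^ 2} :=
      measurableSet_le measurable_const (by fun_prop)
    rw [hν, withDensity_apply _ hmeas, Measure.restrict_restrict hmeas,
      inter_eq_self_of_subset_left hsub]
    exact setLIntegral_norm_rpow_le hβ0 hβ2 (measure_ne_top_of_subset hsub hvΩ)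
  have hlayer := lintegral_comp_eq_lintegral_meas_le_mul ν
    (f := fun y => 4 * π * u y ^ 2) (g := fun t => γ * rexp (γ * t))
    (ae_of_all _ fun y => by positivity) (by fun_prop)
    (fun t _ => Continuous.intervalIntegrable (by fun_prop) _ _)
    (ae_of_all _ fun t => by positivity)
  have hprim (s : ℝ) : ∫ t in (0 : ℝ)..s, γ * rexp (γ * t) = rexp (γ * s) - 1 := by
    have hder (t : ℝ) : HasDerivAt (fun t => rexp (γ * t)) (γ * rexp (γ * t)) t := by
      have := ((hasDerivAt_id t).const_mul γ).exp
      simpa [mul_comm] using this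
    rw [intervalIntegral.integral_eq_sub_of_hasDerivAt (fun t _ => hder t)
      (Continuous.intervalIntegrable (by fun_prop) _ _)]
    simp
  simp_rw [hprim] at hlayer
  calc ∫⁻ x in Ω, ENNReal.ofReal (rexp (γ * (4 * π * u x ^ 2)) / ‖x‖ ^ β)
      = ∫⁻ x, ENNReal.ofReal (rexp (γ * (4 * π * u x ^ 2))) ∂ν := by
        rw [hν, lintegral_withDensity_eq_lintegral_mul _ hwm (by fun_prop)]
        refine lintegral_congr fun x => ?_
        rw [Pi.mul_apply, hw, ← ENNReal.ofReal_mul (by positivity),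
          Real.rpow_neg (norm_nonneg x), div_eq_mul_inv, mul_comm (_⁻¹)]
    _ ≤ ∫⁻ x, (1 + ENNReal.ofReal (rexp (γ * (4 * π * u x ^ 2)) - 1)) ∂ν := by
        refine lintegral_mono fun x => ?_
        rw [← ENNReal.ofReal_one, ← ENNReal.ofReal_add zero_le_one
          (sub_nonneg.2 (Real.one_le_exp (by positivity)))]
        exact ENNReal.ofReal_le_ofReal (by linarith)
    _ = ν univ + ∫⁻ t in Ioi 0, ν {y | t ≤ 4 * π * u y ^ 2} * ENNReal.ofReal (γ * rexp (γ * t)) :=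
      by
        rw [lintegral_add_left measurable_const, lintegral_one, hlayer]
    _ ≤ ENNReal.ofReal (K * M ^ γ) +
        ∫⁻ t in Ioi 0, ENNReal.ofReal (K * γ) * ENNReal.ofReal (m t ^ γ * rexp (γ * t)) := by
        refine add_le_add hνuniv (setLIntegral_mono' measurableSet_Ioi fun t ht => ?_)
        refine (mul_le_mul_left (hνlevel t ht) _).trans_eq ?_
        have : 0 ≤ m t := measureReal_nonneg
        rw [← ENNReal.ofReal_mul (by positivity), ← ENNReal.ofReal_mul (by positivity)]
        congr 1
        ring
    _ ≤ _ := by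
        rw [lintegral_const_mul' _ _ ENNReal.ofReal_ne_top]
        gcongr
        exact lintegral_level_le hM hγ (fun x => measureReal_nonneg) hle hvol

/-- A smooth function on the line which is constant on `(-∞, 1]`, vanishes on
`[2 * R + 3, ∞)`, and decreases with slope at most one by at least `2 * R`. -/
lemma exists_smooth_ramp {R : ℝ} (hR : 0 < R) :
    ∃ ψ : ℝ → ℝ, ∃ H : ℝ, ContDiff ℝ (⊤ : ℕ∞) ψ ∧ 2 * R ≤ H ∧ (∀ s ≤ 1, ψ s = H) ∧
      (∀ s, 2 * R + 3 ≤ s → ψ s = 0) ∧ (∀ s, |deriv ψ s| ≤ 1) ∧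
      ∀ s, s ∉ Ioo 1 (2 * R + 3) → deriv ψ s = 0 := by
  let f : ContDiffBump (R + 2) := ⟨R, R + 1, hR, by linarith⟩
  have hfc : Continuous f := f.continuous
  have hf0 (s : ℝ) (hs : s ∉ Ioo 1 (2 * R + 3)) : f s = 0 := by
    refine f.zero_of_le_dist ?_
    change R + 1 ≤ dist s (R + 2)
    rw [Real.dist_eq, le_abs]
    by_contra! h
    exact hs ⟨by linarith, by linarith⟩
  set T := 2 * R + 3 with hT
  have hder (s : ℝ) : HasDerivAt (fun s => ∫ t in s..T, f t) (-f s) s :=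
    intervalIntegral.integral_hasDerivAt_left (hfc.intervalIntegrable _ _)
      hfc.stronglyMeasurable.stronglyMeasurableAtFilter hfc.continuousAt
  have hderiv : deriv (fun s => ∫ t in s..T, f t) = fun s => -f s := funext fun s => (hder s).deriv
  have hzero (a b : ℝ) (h : ∀ t ∈ uIcc a b, f t = 0) : ∫ t in a..b, f t = 0 := by
    rw [intervalIntegral.integral_congr (g := fun _ => 0) h]
    simp
  refine ⟨fun s => ∫ t in s..T, f t, ∫ t in (1 : ℝ)..T, f t, ?_, ?_, ?_, ?_, ?_, ?_⟩
  · refine contDiff_infty_iff_deriv.2 ⟨fun s => (hder s).differentiableAt, ?_⟩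
    rw [hderiv]
    exact f.contDiff.neg
  · calc 2 * R = ∫ t in (2 : ℝ)..(2 * R + 2), (1 : ℝ) := by simp
      _ = ∫ t in (2 : ℝ)..(2 * R + 2), f t := by
          refine intervalIntegral.integral_congr fun t ht => ?_
          rw [uIcc_of_le (by linarith)] at ht
          refine (f.one_of_mem_closedBall ?_).symm
          change dist t (R + 2) ≤ R
          rw [Real.dist_eq, abs_le]
          constructor <;> linarith [ht.1, ht.2]
      _ ≤ _ := intervalIntegral.integral_mono_interval (by norm_num) (by linarith) (by linarith)
          (ae_of_all _ fun t => f.nonneg) (hfc.intervalIntegrable _ _)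
  · intro s hs
    simp only
    rw [← intervalIntegral.integral_add_adjacent_intervals (b := 1)
      (hfc.intervalIntegrable _ _) (hfc.intervalIntegrable _ _), hzero s 1, zero_add]
    intro t ht
    rw [uIcc_of_le hs] at ht
    exact hf0 t fun h => h.1.not_ge ht.2
  · intro s hs
    refine hzero s T fun t ht => ?_
    rw [uIcc_of_ge hs] at ht
    exact hf0 t fun h => h.2.not_ge ht.1
  · intro s
    rw [hderiv, abs_neg, abs_of_nonneg f.nonneg]
    exact f.le_one
  · intro s hs
    rw [hderiv]
    simp [hf0 s hs]

/-- Smooth Moser functions concentrating at the origin. -/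
lemma exists_moser_function {ρ R : ℝ} (hρ : 0 < ρ) (hR : 0 < R) :
    ∃ u : ℝ² → ℝ, ContDiff ℝ (⊤ : ℕ∞) u ∧ tsupport u ⊆ closedBall 0 ρ ∧
      (∫ x, ‖fderiv ℝ u x‖ ^ 2) ≤ 1 ∧
      ∀ x, ‖x‖ < ρ * rexp (-(2 * (R + 1))) → R ^ 2 / (π * (R + 1)) ≤ u x ^ 2 := by
  obtain ⟨ψ, H, hψ, hH, hψ1, hψ0, hψ', hψ'0⟩ := exists_smooth_ramp hR
  set T := 2 * R + 3 with hT
  set k := rexp T / ρ with hk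
  have hk0 : 0 < k := by positivity
  set A := (√(4 * π * (R + 1)))⁻¹ with hA
  have hA2 : A ^ 2 = (4 * π * (R + 1))⁻¹ := by rw [hA, inv_pow, Real.sq_sqrt (by positivity)]
  have hA0 : 0 < A := by positivity
  set r₀ := ρ * rexp (-(2 * (R + 1))) with hr₀
  have hr₀0 : 0 < r₀ := by positivity
  have hkr₀ : k * r₀ = rexp 1 := by
    rw [hk, hr₀, show rexp T / ρ * (ρ * rexp (-(2 * (R + 1)))) =
      rexp T * rexp (-(2 * (R + 1))) by field_simp, ← Real.exp_add, hT]
    congr 1; ring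
  have hkρ : k * ρ = rexp T := by rw [hk]; field_simp
  set u : ℝ² → ℝ := fun x => A * ψ (Real.log (k * ‖x‖)) with hu
  have hconst (x : ℝ²) (hx : ‖x‖ < r₀) : u x = A * H := by
    rw [hu]
    simp only
    rw [hψ1]
    rcases (norm_nonneg x).eq_or_lt' with h | h
    · rw [h]; simp
    · rw [Real.log_le_iff_le_exp (by positivity), ← hkr₀]
      gcongr
  have hev : u =ᶠ[𝓝 0] fun _ => A * H := by
    filter_upwards [ball_mem_nhds (0 : ℝ²) hr₀0] with x hx
    exact hconst x (by simpa using hx)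
  have hsmooth : ContDiff ℝ (⊤ : ℕ∞) u := by
    rw [contDiff_iff_contDiffAt]
    intro x
    rcases eq_or_ne x 0 with rfl | hx
    · exact contDiffAt_const.congr_of_eventuallyEq hev
    · have h1 : k * ‖x‖ ≠ 0 := mul_ne_zero hk0.ne' (norm_ne_zero_iff.2 hx)
      exact contDiffAt_const.mul (hψ.contDiffAt.comp x
        ((contDiffAt_const.mul (contDiffAt_norm ℝ hx)).log h1))
  have hder (x : ℝ²) : ‖fderiv ℝ u x‖ₑ ^ 2 ≤ ENNReal.ofReal (A ^ 2) *
      {x : ℝ² | ‖x‖ ∈ Ico r₀ ρ}.indicator (fun x => ENNReal.ofReal ((‖x‖ ^ 2)⁻¹)) x := by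
    rcases eq_or_ne x 0 with rfl | hx
    · have h : ‖fderiv ℝ u 0‖ₑ = 0 := by
        rw [hev.fderiv_eq, (hasFDerivAt_const (A * H) (0 : ℝ²)).fderiv,
          ← ofReal_norm, norm_zero, ENNReal.ofReal_zero]
      simp [h]
    have hx0 : 0 < ‖x‖ := norm_pos_iff.2 hx
    have h1 : HasDerivAt (fun s => A * ψ (Real.log (k * s)))
        (A * (deriv ψ (Real.log (k * ‖x‖)) * (k / (k * ‖x‖)))) ‖x‖ := by
      have hl : HasDerivAt (fun s => Real.log (k * s)) (k / (k * ‖x‖)) ‖x‖ := by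
        have := ((hasDerivAt_id ‖x‖).const_mul k).log (mul_ne_zero hk0.ne' hx0.ne')
        simpa using this
      exact (((hψ.differentiable (by simp)) _).hasDerivAt.comp _ hl).const_mul A
    have h2 : HasFDerivAt (fun x : ℝ² => ‖x‖) (fderiv ℝ (fun x : ℝ² => ‖x‖) x) x :=
      ((contDiffAt_norm ℝ hx (n := 1)).differentiableAt (by simp)).hasFDerivAt
    have h3 := (h1.comp_hasFDerivAt x h2).fderiv
    have h4 : ‖fderiv ℝ (fun x : ℝ² => ‖x‖) x‖ ≤ 1 := by
      simpa using norm_fderiv_le_of_lipschitz ℝ (x₀ := x) (lipschitzWith_one_norm (E := ℝ²))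
    have h5 : fderiv ℝ u x = (A * (deriv ψ (Real.log (k * ‖x‖)) * (k / (k * ‖x‖)))) •
      fderiv ℝ (fun x : ℝ² => ‖x‖) x := h3
    have h6 : ‖fderiv ℝ u x‖ ≤ A * |deriv ψ (Real.log (k * ‖x‖))| * ‖x‖⁻¹ := by
      rw [h5, norm_smul, norm_mul, norm_mul, Real.norm_eq_abs, Real.norm_eq_abs, Real.norm_eq_abs,
        abs_of_pos hA0, show k / (k * ‖x‖) = ‖x‖⁻¹ by field_simp, abs_of_pos (inv_pos.2 hx0)]
      refine (mul_le_of_le_one_right (by positivity) h4).trans_eq (by ring)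
    rw [← ofReal_norm, ← ENNReal.ofReal_pow (norm_nonneg _)]
    by_cases hmem : Real.log (k * ‖x‖) ∈ Ioo 1 T
    · have hI : x ∈ {x : ℝ² | ‖x‖ ∈ Ico r₀ ρ} := by
        have hlo := (Real.lt_log_iff_exp_lt (by positivity)).1 hmem.1
        have hhi := (Real.log_lt_iff_lt_exp (by positivity)).1 hmem.2
        rw [← hkr₀] at hlo
        rw [← hkρ] at hhi
        exact ⟨(lt_of_mul_lt_mul_left hlo hk0.le).le, lt_of_mul_lt_mul_left hhi hk0.le⟩
      rw [indicator_of_mem hI, ← ENNReal.ofReal_mul (by positivity), ← inv_pow, ← mul_pow]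
      refine ENNReal.ofReal_le_ofReal (pow_le_pow_left₀ (norm_nonneg _) (h6.trans ?_) 2)
      gcongr
      exact mul_le_of_le_one_right hA0.le (hψ' _)
    · rw [hψ'0 _ hmem] at h6
      have : ‖fderiv ℝ u x‖ = 0 := le_antisymm (by simpa using h6) (norm_nonneg _)
      simp [this]
  refine ⟨u, hsmooth, ?_, ?_, ?_⟩
  · refine closure_minimal (fun x hx => ?_) isClosed_closedBall
    by_contra h
    have h1 : ρ < ‖x‖ := by simpa using h
    refine hx ?_
    rw [hu]
    simp only
    rw [hψ0, mul_zero]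
    rw [Real.le_log_iff_exp_le (by positivity [hρ.trans h1]), ← hkρ]
    gcongr
  · have hc : Continuous fun x => ‖fderiv ℝ u x‖ ^ 2 :=
      (hsmooth.continuous_fderiv (by simp)).norm.pow 2
    rw [integral_eq_lintegral_of_nonneg_ae (ae_of_all _ fun x => sq_nonneg _)
      hc.aestronglyMeasurable]
    refine ENNReal.toReal_le_of_le_ofReal zero_le_one ?_
    have hrρ : r₀ ≤ ρ := mul_le_of_le_one_right hρ.le (Real.exp_le_one_iff.2 (by linarith))
    calc ∫⁻ x, ENNReal.ofReal (‖fderiv ℝ u x‖ ^ 2) ≤ ∫⁻ x, ENNReal.ofReal (A ^ 2) *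
          {x : ℝ² | ‖x‖ ∈ Ico r₀ ρ}.indicator (fun x => ENNReal.ofReal ((‖x‖ ^ 2)⁻¹)) x := by
          refine lintegral_mono fun x => ?_
          rw [ENNReal.ofReal_pow (norm_nonneg _), ofReal_norm]
          exact hder x
      _ = ENNReal.ofReal (A ^ 2) * ENNReal.ofReal (2 * π * Real.log (ρ / r₀)) := by
          have hm : MeasurableSet {x : ℝ² | ‖x‖ ∈ Ico r₀ ρ} := measurable_norm measurableSet_Ico
          rw [lintegral_const_mul' _ _ ENNReal.ofReal_ne_top, lintegral_indicator hm,
            setLIntegral_annulus hr₀0 hrρ]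
      _ = ENNReal.ofReal 1 := by
          rw [← ENNReal.ofReal_mul (by positivity)]
          congr 1
          have : ρ / r₀ = rexp (2 * (R + 1)) := by
            rw [hr₀, Real.exp_neg]; field_simp
          rw [this, Real.log_exp, hA2]
          field_simp
          ring
  · intro x hx
    rw [hconst x hx, mul_pow, hA2]
    calc R ^ 2 / (π * (R + 1)) = (4 * π * (R + 1))⁻¹ * (2 * R) ^ 2 := by field_simp; ring
      _ ≤ _ := by gcongr

lemma not_bounded_supercritical {Ω : Set ℝ²} (hΩo : IsOpen Ω) (h0 : (0 : ℝ²) ∈ Ω) {α β : ℝ}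
    (hα : 0 < α) (hβ0 : 0 ≤ β) (hβ2 : β < 2) (h : 1 < α / (4 * π) + β / 2) {C : ℝ≥0∞}
    (hC : C < ⊤) (hbound : ∀ u : ℝ² → ℝ, ContDiff ℝ (⊤ : ℕ∞) u → tsupport u ⊆ Ω →
      (∫ x, ‖fderiv ℝ u x‖ ^ 2) ≤ 1 →
      ∫⁻ x in Ω, ENNReal.ofReal (rexp (α * u x ^ 2) / ‖x‖ ^ β) ≤ C) : False := by
  obtain ⟨ρ, hρ, hball⟩ := Metric.nhds_basis_closedBall.mem_iff.1 (hΩo.mem_nhds h0)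
  set δ := α / π - 2 * (2 - β) with hδ
  have hδ0 : 0 < δ := by
    have h1 : α / π = 4 * (α / (4 * π)) := by field_simp
    rw [hδ, h1]
    linarith
  have key (R : ℝ) (hR : 0 < R) : π * ρ ^ (2 - β) * rexp (δ * R - (α / π + 2 * (2 - β))) ≤
      C.toReal := by
    obtain ⟨u, hu, hsupp, hen, hval⟩ := exists_moser_function hρ hR
    set r₀ := ρ * rexp (-(2 * (R + 1))) with hr₀
    have hr₀0 : 0 < r₀ := by positivity
    have hrρ : r₀ ≤ ρ := mul_le_of_le_one_right hρ.le (Real.exp_le_one_iff.2 (by linarith))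
    set V := rexp (α * (R ^ 2 / (π * (R + 1)))) / r₀ ^ β with hV
    have hVle : ENNReal.ofReal V * ENNReal.ofReal (π * r₀ ^ 2) ≤ C := by
      have hvol : volume (ball (0 : ℝ²) r₀ \ {0}) = ENNReal.ofReal (π * r₀ ^ 2) := by
        rw [measure_sdiff_null (measure_singleton _), EuclideanSpace.volume_ball]
        simp [Real.sq_sqrt pi_pos.le, one_add_one_eq_two, ENNReal.ofReal_mul pi_pos.le,
          ENNReal.ofReal_pow hr₀0.le, mul_comm]
      refine le_trans ?_ (hbound u hu (hsupp.trans hball) hen)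
      rw [← hvol, ← setLIntegral_const]
      have hsub : ball (0 : ℝ²) r₀ \ {0} ⊆ Ω := fun x hx =>
        hball (closedBall_subset_closedBall hrρ (ball_subset_closedBall hx.1))
      refine le_trans ?_ (lintegral_mono_set hsub)
      refine setLIntegral_mono' (measurableSet_ball.diff (measurableSet_singleton _))
        fun x hx => ENNReal.ofReal_le_ofReal ?_
      have hxr : ‖x‖ < r₀ := by simpa using hx.1
      have hx0 : 0 < ‖x‖ := norm_pos_iff.2 hx.2
      have := hval x hxr
      rw [hV]
      gcongr
    have hVle' : V * (π * r₀ ^ 2) ≤ C.toReal := by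
      rw [← ENNReal.ofReal_mul (by positivity)] at hVle
      exact (ENNReal.ofReal_le_iff_le_toReal hC.ne).1 hVle
    refine le_trans ?_ hVle'
    have h1 : V * (π * r₀ ^ 2) =
        π * r₀ ^ (2 - β) * rexp (α * (R ^ 2 / (π * (R + 1)))) := by
      rw [hV, Real.rpow_sub hr₀0, Real.rpow_two]
      ring
    rw [h1, hr₀, Real.mul_rpow hρ.le (Real.exp_pos _).le, ← Real.exp_mul, mul_assoc, mul_assoc,
      mul_assoc, ← Real.exp_add]
    gcongr
    have h2 : R - 1 ≤ R ^ 2 / (R + 1) := by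
      rw [le_div_iff₀ (by positivity)]
      nlinarith
    have h3 : α * (R ^ 2 / (π * (R + 1))) = α / π * (R ^ 2 / (R + 1)) := by field_simp
    have h4 : α / π * (R - 1) ≤ α / π * (R ^ 2 / (R + 1)) := by gcongr
    rw [h3, hδ]
    linarith
  set B := π * ρ ^ (2 - β) with hB
  have hB0 : 0 < B := by positivity
  have hC0 : 0 ≤ C.toReal := ENNReal.toReal_nonneg
  have hκ : 0 ≤ α / π + 2 * (2 - β) := by
    have : 0 ≤ 2 - β := by linarith
    positivity
  set R := (C.toReal / B + (α / π + 2 * (2 - β)) + 1) / δ with hR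
  have hk := key R (by positivity)
  have h1 : δ * R - (α / π + 2 * (2 - β)) = C.toReal / B + 1 := by
    rw [hR, mul_div_cancel₀ _ hδ0.ne']
    ring
  rw [h1] at hk
  have h2 := Real.add_one_le_exp (C.toReal / B + 1)
  have h3 : B * (C.toReal / B + 1 + 1) ≤ B * rexp (C.toReal / B + 1) := by gcongr
  have h4 : B * (C.toReal / B + 1 + 1) = C.toReal + 2 * B := by field_simp; ring
  linarith

end TrudingerMoser

/-- Singular Trudinger–Moser inequality, uniform part (Adimurthi–Sandeep):
the supremum over the unit ball of `H¹₀(Ω)` (represented through smooth compactly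
supported functions, a dense subspace) is finite iff `α/(4π) + β/2 ≤ 1`. -/
theorem stmt11 (Ω : Set (EuclideanSpace ℝ (Fin 2))) (hΩo : IsOpen Ω) (hΩconn : IsConnected Ω)
    (hΩb : Bornology.IsBounded Ω) (h0 : (0 : EuclideanSpace ℝ (Fin 2)) ∈ Ω)
    (α β : ℝ) (hα : 0 < α) (hβ0 : 0 ≤ β) (hβ2 : β < 2) :
    (∃ C : ℝ≥0∞, C < ⊤ ∧ ∀ u : EuclideanSpace ℝ (Fin 2) → ℝ,
        ContDiff ℝ (⊤ : ℕ∞) u → tsupport u ⊆ Ω →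
        (∫ x, ‖fderiv ℝ u x‖ ^ 2) ≤ 1 →
        ∫⁻ x in Ω, ENNReal.ofReal (Real.exp (α * u x ^ 2) / ‖x‖ ^ β) ≤ C) ↔
      α / (4 * π) + β / 2 ≤ 1 := by
  constructor
  · rintro ⟨C, hC, hbound⟩
    by_contra! h
    exact TrudingerMoser.not_bounded_supercritical hΩo h0 hα hβ0 hβ2 h hC hbound
  · intro h
    obtain ⟨C, hC, hbound⟩ := TrudingerMoser.exists_bound_critical hΩo hΩb h0 hβ0 hβ2
    refine ⟨C, hC, fun u hu hs hen => (lintegral_mono fun x => ?_).trans (hbound u hu hs hen)⟩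
    refine ENNReal.ofReal_le_ofReal ?_
    have h1 : α ≤ (1 - β / 2) * (4 * π) := by
      rw [← div_le_iff₀ (by positivity)]
      linarith
    rw [← mul_assoc (1 - β / 2)]
    gcongr
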